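/- Let k₁ = 2, d = t, and 2 ≤ t ≤ k₂. For every minimal nonempty subset S ⊆ [2]×[k₂], the Krull dimension of ℂ[X]/I_S is at most t² + (t−1)k₂ − (t−1)² − 1. -/

import Mathlib

noncomputable section

open MvPolynomial

namespace CI

/-- The column index set `[k₁] × [k₂]`. -/
abbrev Col (k₁ k₂ : ℕ) := Fin k₁ × Fin k₂

/-- The polynomial ring `ℂ[X]` in the entries of the `d × (k₁k₂)` matrix `X` of
indeterminates `x_{i,(j,ℓ)}`. -/
abbrev MvP (d k₁ k₂ : ℕ) := MvPolynomial (Fin d × Col k₁ k₂) ℂ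

/-- The `r × r` minor of `X` with rows `a` and columns `b`. -/
def minorPoly (d k₁ k₂ r : ℕ) (a : Fin r → Fin d) (b : Fin r → Col k₁ k₂) :
    MvP d k₁ k₂ :=
  (Matrix.of fun i j => (X (a i, b j) : MvP d k₁ k₂)).det

/-- `F_r(X_U)`: the set of all `r × r` minors of the submatrix `X_U`. -/
def minorSet (d k₁ k₂ r : ℕ) (U : Set (Col k₁ k₂)) : Set (MvP d k₁ k₂) :=
  { f | ∃ a : Fin r → Fin d, ∃ b : Fin r → Col k₁ k₂,
      Function.Injective a ∧ Function.Injective b ∧ (∀ i, b i ∈ U) ∧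
      f = minorPoly d k₁ k₂ r a b }

/-- `I_r(X_U)`: the ideal generated by the `r × r` minors of `X_U`. -/
def minorIdeal (d k₁ k₂ r : ℕ) (U : Set (Col k₁ k₂)) : Ideal (MvP d k₁ k₂) :=
  Ideal.span (minorSet d k₁ k₂ r U)

/-- The row slice `R_i = {i} × [k₂]`. -/
def rowSlice (k₁ k₂ : ℕ) (i : Fin k₁) : Set (Col k₁ k₂) := { p | p.1 = i }

/-- The column slice `C_j = [k₁] × {j}`. -/
def colSlice (k₁ k₂ : ℕ) (j : Fin k₂) : Set (Col k₁ k₂) := { p | p.2 = j }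

/-- The conditional independence ideal `𝓘_C = Σ_j I_2(X_{C_j}) + Σ_i I_t(X_{R_i})`. -/
def ciIdeal (d k₁ k₂ t : ℕ) : Ideal (MvP d k₁ k₂) :=
  (⨆ j : Fin k₂, minorIdeal d k₁ k₂ 2 (colSlice k₁ k₂ j)) ⊔
    ⨆ i : Fin k₁, minorIdeal d k₁ k₂ t (rowSlice k₁ k₂ i)

/-- `I_∅ = I_t(X) + Σ_j I_2(X_{C_j})`. -/
def Iempty (d k₁ k₂ t : ℕ) : Ideal (MvP d k₁ k₂) :=
  minorIdeal d k₁ k₂ t Set.univ ⊔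
    ⨆ j : Fin k₂, minorIdeal d k₁ k₂ 2 (colSlice k₁ k₂ j)

/-! ### The case `k₁ = 2`: the ideals `I_S` -/

/-- The column slice `C_j` does not meet `S`. -/
def colOK (k₂ : ℕ) (S : Set (Col 2 k₂)) (j : Fin k₂) : Prop := ∀ i : Fin 2, (i, j) ∉ S

/-- `𝒞(S)`: the union of all column slices not meeting `S`. -/
def CSet (k₂ : ℕ) (S : Set (Col 2 k₂)) : Set (Col 2 k₂) := { p | colOK k₂ S p.2 }

/-- The condition `Z(1,S) ∖ Z(2,S) ≠ ∅` and `Z(2,S) ∖ Z(1,S) ≠ ∅` under which the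
`(t-1)`-minors are included in `F_S`. -/
def tCond (k₂ : ℕ) (S : Set (Col 2 k₂)) : Prop :=
  (∃ ℓ, ((0 : Fin 2), ℓ) ∈ S ∧ ((1 : Fin 2), ℓ) ∉ S) ∧
  (∃ ℓ, ((1 : Fin 2), ℓ) ∈ S ∧ ((0 : Fin 2), ℓ) ∉ S)

/-- The generating set `F_S` of the ideal `I_S` (for `k₁ = 2`). -/
def FSset (d k₂ t : ℕ) (S : Set (Col 2 k₂)) : Set (MvP d 2 k₂) :=
  minorSet d 2 k₂ 1 S ∪
  (⋃ j ∈ { j : Fin k₂ | colOK k₂ S j }, minorSet d 2 k₂ 2 (colSlice 2 k₂ j)) ∪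
  (⋃ _ : tCond k₂ S, minorSet d 2 k₂ (t - 1) (CSet k₂ S)) ∪
  minorSet d 2 k₂ t ((rowSlice 2 k₂ 0 \ S) ∪ CSet k₂ S) ∪
  minorSet d 2 k₂ t ((rowSlice 2 k₂ 1 \ S) ∪ CSet k₂ S)

/-- The ideal `I_S ⊆ ℂ[X]` for `S ⊆ [2] × [k₂]`, generated by `F_S`. -/
def ISIdeal (d k₂ t : ℕ) (S : Set (Col 2 k₂)) : Ideal (MvP d 2 k₂) :=
  Ideal.span (FSset d k₂ t S)

/-- `u = min(|R₁ ∩ S|, |R₂ ∩ S|)`, the first entry of the combinatorial type of `S`. -/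
def uOf (k₂ : ℕ) (S : Set (Col 2 k₂)) : ℕ :=
  min ((rowSlice 2 k₂ 0 ∩ S).ncard) ((rowSlice 2 k₂ 1 ∩ S).ncard)

/-- `v = max(|R₁ ∩ S|, |R₂ ∩ S|)`, the second entry of the combinatorial type of `S`. -/
def vOf (k₂ : ℕ) (S : Set (Col 2 k₂)) : ℕ :=
  max ((rowSlice 2 k₂ 0 ∩ S).ncard) ((rowSlice 2 k₂ 1 ∩ S).ncard)

/-- `S` contains no column slice. -/
def noColumn (k₂ : ℕ) (S : Set (Col 2 k₂)) : Prop :=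
  ∀ j : Fin k₂, ¬ colSlice 2 k₂ j ⊆ S

/-- A subset `S ⊆ [2] × [k₂]` is minimal: `S = ∅`, or `S` contains no column slice,
its combinatorial type `(u,v)` satisfies `1 ≤ u ≤ v ≤ k₂ - t + 1`, and `u + v = k₂`
in case `t = 2`. -/
def minimalSubset (k₂ t : ℕ) (S : Set (Col 2 k₂)) : Prop :=
  S = ∅ ∨ (noColumn k₂ S ∧ 1 ≤ uOf k₂ S ∧ uOf k₂ S ≤ vOf k₂ S ∧
    vOf k₂ S ≤ k₂ - t + 1 ∧ (t = 2 → uOf k₂ S + vOf k₂ S = k₂))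

/-! ### Hypergraphs and their closure -/

/-- The hypergraph `H(S)` on `[k₁] × [k₂]`: its hyperedges are (1) the singletons of
elements of `S`; (2) the 2-subsets of a column slice disjoint from `S`; (3) the
`(t-1)`-subsets of `{i,j} × (NZ(i,S) ∩ NZ(j,S))` for distinct rows `i, j` with
`Z(i,S) ∖ Z(j,S) ≠ ∅` and `Z(j,S) ∖ Z(i,S) ≠ ∅`; (4) the `t`-subsets of a row slice
disjoint from `S`. -/
def HS (k₁ k₂ t : ℕ) (S : Set (Col k₁ k₂)) : Set (Finset (Col k₁ k₂)) :=
  { e | (∃ p ∈ S, e = {p})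
      ∨ (e.card = 2 ∧ (∃ j, ∀ p ∈ e, p.2 = j) ∧ ∀ p ∈ e, p ∉ S)
      ∨ (e.card = t - 1 ∧ ∃ i j : Fin k₁, i ≠ j ∧
           (∃ ℓ, (i, ℓ) ∈ S ∧ (j, ℓ) ∉ S) ∧ (∃ ℓ, (j, ℓ) ∈ S ∧ (i, ℓ) ∉ S) ∧
           ∀ p ∈ e, (p.1 = i ∨ p.1 = j) ∧ (i, p.2) ∉ S ∧ (j, p.2) ∉ S)
      ∨ (e.card = t ∧ (∃ i, ∀ p ∈ e, p.1 = i) ∧ ∀ p ∈ e, p ∉ S) }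

/-- The closure of a hypergraph: iterate the rule "if `{a,b}` and `e` (with `a ∈ e`)
are hyperedges, then add `(e ∖ {a}) ∪ {b}`". -/
inductive HClosure {k₁ k₂ : ℕ} (H : Set (Finset (Col k₁ k₂))) :
    Finset (Col k₁ k₂) → Prop
  | base {e : Finset (Col k₁ k₂)} : e ∈ H → HClosure H e
  | step {e : Finset (Col k₁ k₂)} (a b : Col k₁ k₂) :
      a ∈ e → HClosure H {a, b} → HClosure H e → HClosure H (insert b (e.erase a))

/-- The determinantal ideal of a hypergraph: it is generated by the minors `[A|B]`
with `A ⊆ [d]`, `B` a hyperedge, and `|A| = |B|`. -/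
def hypIdeal (d k₁ k₂ : ℕ) (H : Set (Finset (Col k₁ k₂))) : Ideal (MvP d k₁ k₂) :=
  Ideal.span { f | ∃ e ∈ H, ∃ a : Fin e.card → Fin d, ∃ b : Fin e.card → Col k₁ k₂,
      Function.Injective a ∧ Function.Injective b ∧ (∀ i, b i ∈ e) ∧
      f = minorPoly d k₁ k₂ e.card a b }

/-- The ideal `I_S` associated to the closure of the hypergraph `H(S)`. -/
def ISclosure (d k₁ k₂ t : ℕ) (S : Set (Col k₁ k₂)) : Ideal (MvP d k₁ k₂) :=
  hypIdeal d k₁ k₂ { e | HClosure (HS k₁ k₂ t S) e }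

/-! ### The lexicographic monomial order -/

/-- `varLT a b` means the variable `x_a` is *larger* than `x_b` in the variable order
`x_{1,(1,1)} > x_{2,(1,1)} > ⋯ > x_{d,(1,1)} > x_{1,(2,1)} > ⋯ > x_{d,(k₁,k₂)}`,
i.e. `(ℓ, j, i)` precedes `(ℓ', j', i')` lexicographically, where `a = (i, (j, ℓ))`. -/
def varLT (d k₁ k₂ : ℕ) (a b : Fin d × Col k₁ k₂) : Prop :=
  Prod.Lex (· < ·) (Prod.Lex (· < ·) (· < ·))
    (a.2.2, (a.2.1, a.1)) (b.2.2, (b.2.1, b.1))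

/-- `m ≺ m'` in the lexicographic monomial order determined by the variable order:
at the largest variable where the exponents differ, `m` has the smaller exponent. -/
def monLT (d k₁ k₂ : ℕ) (m m' : (Fin d × Col k₁ k₂) →₀ ℕ) : Prop :=
  ∃ v, (∀ w, varLT d k₁ k₂ w v → m w = m' w) ∧ m v < m' v

/-- `m` is the `≺`-leading monomial of `f`. -/
def IsLeadMon (d k₁ k₂ : ℕ) (f : MvP d k₁ k₂) (m : (Fin d × Col k₁ k₂) →₀ ℕ) : Prop :=
  m ∈ f.support ∧ ∀ m' ∈ f.support, m' = m ∨ monLT d k₁ k₂ m' m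

/-- `G` is a Gröbner basis of `I` with respect to the lexicographic order `≺`:
`G` is contained in `I` and for every nonzero `f ∈ I` there is a `g ∈ G` whose
`≺`-leading monomial divides the `≺`-leading monomial of `f`. -/
def IsGB (d k₁ k₂ : ℕ) (G : Set (MvP d k₁ k₂)) (I : Ideal (MvP d k₁ k₂)) : Prop :=
  G ⊆ (I : Set (MvP d k₁ k₂)) ∧ ∀ f ∈ I, f ≠ 0 →
    ∃ g ∈ G, ∃ mg, IsLeadMon d k₁ k₂ g mg ∧
      ∀ mf, IsLeadMon d k₁ k₂ f mf → ∀ x, mg x ≤ mf x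

/-! ### The matrix `D_A` -/

/-- For `A ∈ ℂ^{k₂ × (k₁-1)}`, the `k₂ × (k₁k₂)` matrix `D_A`: its row `r` has entry
`1` in the column indexed by `(1, r)`, entry `A r ℓ` in the column indexed by
`(1+ℓ, r)` for `ℓ ∈ [k₁-1]`, and zeros elsewhere. -/
def DMat (k₁ k₂ : ℕ) (A : Matrix (Fin k₂) (Fin (k₁ - 1)) ℂ) :
    Matrix (Fin k₂) (Col k₁ k₂) ℂ := fun r c =>
  if c.2 = r then
    (if _h : (c.1 : ℕ) = 0 then 1
     else A r ⟨(c.1 : ℕ) - 1, by have := c.1.isLt; omega⟩)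
  else 0

end CI

namespace CI

/-! ### Krull dimension and generators of the fraction field -/

theorem ringKrullDim_quotient_le_of_forall_isPrime {R : Type*} [CommRing R] (I : Ideal R)
    (D : WithBot ℕ∞) (h : ∀ P : Ideal R, P.IsPrime → I ≤ P → ringKrullDim (R ⧸ P) ≤ D) :
    ringKrullDim (R ⧸ I) ≤ D := by
  rw [ringKrullDim_quotient]
  refine iSup_le fun p => ?_
  refine le_trans ?_ (h p.head.1.asIdeal p.head.1.isPrime p.head.2)
  rw [ringKrullDim_quotient]
  let q : LTSeries (PrimeSpectrum.zeroLocus (R := R) p.head.1.asIdeal) :=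
    { length := p.length
      toFun := fun i => ⟨(p i).1, p.head_le i⟩
      step := fun i => p.step i }
  exact Order.LTSeries.length_le_krullDim q

theorem ringKrullDim_le_of_isIntegral {R A : Type*} [CommRing R] [CommRing A]
    (g : R →+* A) (hg : g.IsIntegral) : ringKrullDim A ≤ ringKrullDim R := by
  let := g.toAlgebra
  have : Algebra.IsIntegral R A := ⟨hg⟩
  refine Order.krullDim_le_of_strictMono (PrimeSpectrum.comap (algebraMap R A)) ?_
  intro I J hIJ
  exact Ideal.IsIntegral.comap_lt_comap (R := R) (I := I.asIdeal) (J := J.asIdeal) hIJ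

theorem ringKrullDim_le_of_trdeg_le (k A : Type) [Field k] [CommRing A] [IsDomain A]
    [Algebra k A] [Algebra.FiniteType k A] (n : ℕ) (h : Algebra.trdeg k A ≤ n) :
    ringKrullDim A ≤ n := by
  obtain ⟨s, g, hinj, hint⟩ := exists_integral_inj_algHom_of_fg k A
  have h1 := trdeg_le_of_injective g hinj
  rw [MvPolynomial.trdeg_of_isDomain] at h1
  have h2 : s ≤ n := by
    have := h1.trans h
    simpa using this
  refine (ringKrullDim_le_of_isIntegral g.toRingHom hint).trans ?_
  rw [MvPolynomial.ringKrullDim_of_isNoetherianRing, ringKrullDim_eq_zero_of_field]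
  simp only [Nat.card_eq_fintype_card, Fintype.card_fin, zero_add]
  exact_mod_cast h2

theorem trdeg_le_card_of_adjoin_eq_top {k K : Type} [Field k] [Field K] [Algebra k K]
    (T : Finset K) (hT : IntermediateField.adjoin k (T : Set K) = ⊤) :
    Algebra.trdeg k K ≤ T.card := by
  have : Algebra.IsAlgebraic (Algebra.adjoin k (T : Set K)) K := by
    constructor
    intro x
    have hx : x ∈ IntermediateField.adjoin k (T : Set K) := by rw [hT]; trivial
    rw [IntermediateField.mem_adjoin_iff_div] at hx
    obtain ⟨r, hr, s, hs, rfl⟩ := hx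
    have h1 := isAlgebraic_algebraMap (A := K) (⟨r, hr⟩ : Algebra.adjoin k (T : Set K))
    have h2 := isAlgebraic_algebraMap (A := K) (⟨s, hs⟩ : Algebra.adjoin k (T : Set K))
    rw [div_eq_mul_inv]
    exact h1.mul h2.inv
  simpa using Algebra.IsAlgebraic.trdeg_le_cardinalMk k (T : Set K)

/-! ### Vanishing minors and annihilating functionals -/

theorem exists_dotProduct_eq_zero {K ι : Type*} [Field K] {r : ℕ} (v : ι → Fin r → K)
    (U : Set ι) (h : ∀ b : Fin r → ι, Function.Injective b → (∀ i, b i ∈ U) →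
      (Matrix.of fun i j => v (b j) i).det = 0) :
    ∃ φ : Fin r → K, φ ≠ 0 ∧ ∀ b ∈ U, φ ⬝ᵥ v b = 0 := by
  by_cases hsp : Submodule.span K (Set.range fun b : U => v b) = ⊤
  · exfalso
    obtain ⟨κ, a, ha, hspan, hli⟩ := exists_linearIndependent' K (fun b : U => v b)
    let B := Module.Basis.mk hli (by rw [hspan, hsp])
    let e := B.indexEquiv (Pi.basisFun K (Fin r))
    have hdet := h (fun i => (a (e.symm i)).1)
      (Subtype.val_injective.comp (ha.comp e.symm.injective)) (fun i => (a (e.symm i)).2)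
    have hcol : LinearIndependent K
        (Matrix.of fun i j => v ((a (e.symm j)).1) i : Matrix (Fin r) (Fin r) K).col :=
      hli.comp e.symm e.symm.injective
    rw [Matrix.linearIndependent_cols_iff_isUnit, Matrix.isUnit_iff_isUnit_det, hdet] at hcol
    exact not_isUnit_zero hcol
  · obtain ⟨f, hf, hker⟩ := Submodule.exists_le_ker_of_lt_top _ (lt_top_iff_ne_top.2 hsp)
    have hfe : ∀ w, f w = (fun i => f (Pi.single i 1)) ⬝ᵥ w := by
      intro w
      rw [LinearMap.pi_apply_eq_sum_univ f w, dotProduct]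
      refine Finset.sum_congr rfl fun i _ => ?_
      rw [smul_eq_mul, mul_comm]
      congr 2
      ext j
      simp [Pi.single_apply, eq_comm]
    refine ⟨fun i => f (Pi.single i 1), ?_, ?_⟩
    · intro h0
      apply hf
      ext w
      rw [LinearMap.comp_apply, hfe, h0]
      simp
    · intro b hb
      rw [← hfe]
      exact hker (Submodule.subset_span ⟨⟨b, hb⟩, rfl⟩)

/-- The functionals cutting out two hyperplanes that contain a common family of codimension at
least two can be normalized so that they depend on at most `2 * n` parameters. -/
theorem exists_normalized_functionals {k K ι : Type*} [Field k] [Field K] [Algebra k K] {n : ℕ}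
    (v : ι → Fin (n + 1) → K) (C U₁ U₂ : Set ι) (hC₁ : C ⊆ U₁) (hC₂ : C ⊆ U₂)
    (h₁ : ∃ φ : Fin (n + 1) → K, φ ≠ 0 ∧ ∀ b ∈ U₁, φ ⬝ᵥ v b = 0)
    (h₂ : ∃ φ : Fin (n + 1) → K, φ ≠ 0 ∧ ∀ b ∈ U₂, φ ⬝ᵥ v b = 0)
    (h₃ : ∀ p, ∃ φ : Fin (n + 1) → K, φ ≠ 0 ∧ φ p = 0 ∧ ∀ b ∈ C, φ ⬝ᵥ v b = 0) :
    ∃ (T : Finset K) (p q : Fin (n + 1)) (φ ψ χ : Fin (n + 1) → K), T.card ≤ 2 * n ∧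
      φ p = 1 ∧ ψ p = 0 ∧ ψ q = 1 ∧ χ ≠ 0 ∧
      (∀ i, φ i ∈ IntermediateField.adjoin k (T : Set K)) ∧
      (∀ i, ψ i ∈ IntermediateField.adjoin k (T : Set K)) ∧
      (∀ i, χ i ∈ IntermediateField.adjoin k (T : Set K)) ∧
      (∀ b ∈ U₁, φ ⬝ᵥ v b = 0) ∧ (∀ b ∈ C, ψ ⬝ᵥ v b = 0) ∧ (∀ b ∈ U₂, χ ⬝ᵥ v b = 0) := by
  classical
  have key : ∃ (p q : Fin (n + 1)) (φ ψ χ : Fin (n + 1) → K) (c : K),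
      φ p = 1 ∧ ψ p = 0 ∧ ψ q = 1 ∧ χ ≠ 0 ∧ (χ = φ ∨ χ = c • φ + ψ) ∧
      (∀ b ∈ U₁, φ ⬝ᵥ v b = 0) ∧ (∀ b ∈ C, ψ ⬝ᵥ v b = 0) ∧ (∀ b ∈ U₂, χ ⬝ᵥ v b = 0) := by
    obtain ⟨φ₀, hφ₀, hφU⟩ := h₁
    obtain ⟨χ₀, hχ₀, hχU⟩ := h₂
    obtain ⟨p, hp⟩ := Function.ne_iff.1 hφ₀
    rw [Pi.zero_apply] at hp
    obtain ⟨φ, hφp, hφU₁⟩ : ∃ φ : Fin (n + 1) → K, φ p = 1 ∧ ∀ b ∈ U₁, φ ⬝ᵥ v b = 0 :=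
      ⟨(φ₀ p)⁻¹ • φ₀, by simp [hp], fun b hb => by rw [smul_dotProduct, hφU b hb, smul_zero]⟩
    by_cases hψ : χ₀ - χ₀ p • φ = 0
    · obtain ⟨ψ₀, hψ₀, hψp, hψC⟩ := h₃ p
      obtain ⟨q, hq⟩ := Function.ne_iff.1 hψ₀
      rw [Pi.zero_apply] at hq
      rw [sub_eq_zero] at hψ
      have hχp : χ₀ p ≠ 0 := by
        intro h0
        rw [h0, zero_smul] at hψ
        exact hχ₀ hψ
      refine ⟨p, q, φ, (ψ₀ q)⁻¹ • ψ₀, φ, 0, hφp, by simp [hψp], by simp [hq], ?_, Or.inl rfl,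
        hφU₁, fun b hb => by rw [smul_dotProduct, hψC b hb, smul_zero], ?_⟩
      · intro h0
        simp [h0] at hφp
      · intro b hb
        have := hχU b hb
        rw [hψ, smul_dotProduct, smul_eq_mul] at this
        exact (mul_eq_zero.1 this).resolve_left hχp
    · obtain ⟨q, hq⟩ := Function.ne_iff.1 hψ
      rw [Pi.zero_apply] at hq
      set ψ₀ := χ₀ - χ₀ p • φ with hψ₀
      refine ⟨p, q, φ, (ψ₀ q)⁻¹ • ψ₀, (ψ₀ q)⁻¹ • χ₀, (ψ₀ q)⁻¹ * χ₀ p, hφp, ?_, by simp [hq], ?_,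
        Or.inr ?_, hφU₁, ?_, fun b hb => by rw [smul_dotProduct, hχU b hb, smul_zero]⟩
      · simp [hψ₀, hφp]
      · exact smul_ne_zero (inv_ne_zero hq) hχ₀
      · rw [mul_smul, ← smul_add, hψ₀, add_sub_cancel]
      · intro b hb
        rw [smul_dotProduct, hψ₀, sub_dotProduct, smul_dotProduct, hχU b (hC₂ hb),
          hφU₁ b (hC₁ hb)]
        simp
  obtain ⟨p, q, φ, ψ, χ, c, hφp, hψp, hψq, hχ, hcases, hU₁, hC, hU₂⟩ := key
  have hqp : q ≠ p := by
    rintro rfl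
    exact zero_ne_one (hψp.symm.trans hψq)
  set T : Finset K := (Finset.univ.erase p).image φ ∪
    (insert c (((Finset.univ.erase p).erase q).image ψ)) with hT
  have hsub := IntermediateField.subset_adjoin k (T : Set K)
  have hφF : ∀ i, φ i ∈ IntermediateField.adjoin k (T : Set K) := by
    intro i
    by_cases hi : i = p
    · rw [hi, hφp]; exact one_mem _
    · exact hsub (Finset.mem_coe.2 (Finset.mem_union_left _
        (Finset.mem_image_of_mem _ (by simp [hi]))))
  have hψF : ∀ i, ψ i ∈ IntermediateField.adjoin k (T : Set K) := by
    intro i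
    by_cases hi : i = p
    · rw [hi, hψp]; exact zero_mem _
    by_cases hi' : i = q
    · rw [hi', hψq]; exact one_mem _
    · exact hsub (Finset.mem_coe.2 (Finset.mem_union_right _ (Finset.mem_insert_of_mem
        (Finset.mem_image_of_mem _ (by simp [hi, hi'])))))
  have hcF : c ∈ IntermediateField.adjoin k (T : Set K) :=
    hsub (Finset.mem_coe.2 (Finset.mem_union_right _ (Finset.mem_insert_self _ _)))
  refine ⟨T, p, q, φ, ψ, χ, ?_, hφp, hψp, hψq, hχ, hφF, hψF, ?_, hU₁, hC, hU₂⟩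
  · have e₁ : (Finset.univ.erase p).card = n := by simp
    have e₂ : ((Finset.univ.erase p).erase q).card = n - 1 := by
      rw [Finset.card_erase_of_mem (by simp [hqp]), e₁]
    have hn : 0 < n := by
      rw [← e₁]
      exact Finset.card_pos.2 ⟨q, by simp [hqp]⟩
    have i₁ := Finset.card_image_le (s := Finset.univ.erase p) (f := φ)
    have i₂ := Finset.card_image_le (s := (Finset.univ.erase p).erase q) (f := ψ)
    have i₃ := Finset.card_insert_le c (((Finset.univ.erase p).erase q).image ψ)
    have i₄ := Finset.card_union_le ((Finset.univ.erase p).image φ)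
      (insert c (((Finset.univ.erase p).erase q).image ψ))
    rw [hT]
    omega
  · intro i
    rcases hcases with rfl | rfl
    · exact hφF i
    · exact add_mem (mul_mem hcF (hφF i)) (hψF i)

/-! ### Parameters for the columns -/

section Columns

variable {k K : Type*} [Field k] [Field K] [Algebra k K] {n : ℕ}

theorem mem_of_dotProduct_eq_zero (F : IntermediateField k K) {φ x : Fin (n + 1) → K}
    (h : φ ⬝ᵥ x = 0) (q : Fin (n + 1)) (hq : φ q ≠ 0) (hqF : φ q ∈ F)
    (hF : ∀ i, i ≠ q → φ i * x i ∈ F) : x q ∈ F := by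
  classical
  rw [dotProduct, ← Finset.add_sum_erase _ _ (Finset.mem_univ q)] at h
  have hmem : φ q * x q ∈ F := by
    rw [eq_neg_of_add_eq_zero_left h]
    exact neg_mem (sum_mem fun i hi => hF i (Finset.ne_of_mem_erase hi))
  rw [← inv_mul_cancel_left₀ hq (x q)]
  exact mul_mem (inv_mem hqF) hmem

theorem exists_params_of_hyperplane {χ x : Fin (n + 1) → K} (hχ : χ ≠ 0) (h : χ ⬝ᵥ x = 0) :
    ∃ T : Finset K, T.card ≤ n ∧ ∀ F : IntermediateField k K, (∀ i, χ i ∈ F) →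
      (T : Set K) ⊆ F → ∀ i, x i ∈ F := by
  classical
  obtain ⟨q, hq⟩ := Function.ne_iff.1 hχ
  refine ⟨(Finset.univ.erase q).image x, Finset.card_image_le.trans (by simp), ?_⟩
  intro F hF hT
  have hx : ∀ i, i ≠ q → x i ∈ F := fun i hi =>
    hT (Finset.mem_coe.2 (Finset.mem_image_of_mem _ (by simp [hi])))
  intro i
  by_cases hi : i = q
  · subst hi
    exact mem_of_dotProduct_eq_zero F h i hq (hF i) fun j hj => mul_mem (hF j) (hx j hj)
  · exact hx i hi

theorem exists_params_of_codim_two {φ ψ x : Fin (n + 1) → K} {p q : Fin (n + 1)}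
    (hφp : φ p = 1) (hψp : ψ p = 0) (hψq : ψ q = 1) (hφ : φ ⬝ᵥ x = 0) (hψ : ψ ⬝ᵥ x = 0) :
    ∃ T : Finset K, T.card + 1 ≤ n ∧ ∀ F : IntermediateField k K, (∀ i, φ i ∈ F) →
      (∀ i, ψ i ∈ F) → (T : Set K) ⊆ F → ∀ i, x i ∈ F := by
  classical
  have hqp : q ≠ p := by
    rintro rfl
    exact zero_ne_one (hψp.symm.trans hψq)
  refine ⟨((Finset.univ.erase p).erase q).image x, ?_, ?_⟩
  · have e₁ : (Finset.univ.erase p).card = n := by simp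
    have e₂ := Finset.card_erase_add_one (s := Finset.univ.erase p) (a := q) (by simp [hqp])
    have := Finset.card_image_le (s := (Finset.univ.erase p).erase q) (f := x)
    omega
  · intro F hφF hψF hT
    have hx : ∀ i, i ≠ p → i ≠ q → x i ∈ F := fun i hi hi' =>
      hT (Finset.mem_coe.2 (Finset.mem_image_of_mem _ (by simp [hi, hi'])))
    have hxq : x q ∈ F := by
      refine mem_of_dotProduct_eq_zero F hψ q (by simp [hψq]) (hψF q) fun i hi => ?_
      by_cases hip : i = p
      · rw [hip, hψp, zero_mul]; exact zero_mem _
      · exact mul_mem (hψF i) (hx i hip hi)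
    have hx' : ∀ i, i ≠ p → x i ∈ F := fun i hi => by
      by_cases hiq : i = q
      · rw [hiq]; exact hxq
      · exact hx i hi hiq
    intro i
    by_cases hi : i = p
    · subst hi
      exact mem_of_dotProduct_eq_zero F hφ i (by simp [hφp]) (hφF i)
        fun j hj => mul_mem (hφF j) (hx' j hj)
    · exact hx' i hi

theorem exists_params_of_parallel {φ ψ x y : Fin (n + 1) → K} {p q : Fin (n + 1)}
    (hφp : φ p = 1) (hψp : ψ p = 0) (hψq : ψ q = 1) (hφx : φ ⬝ᵥ x = 0) (hψx : ψ ⬝ᵥ x = 0)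
    (hφy : φ ⬝ᵥ y = 0) (hψy : ψ ⬝ᵥ y = 0) (hxy : ∀ i j, x i * y j = x j * y i) :
    ∃ T : Finset K, T.card ≤ n ∧ ∀ F : IntermediateField k K, (∀ i, φ i ∈ F) →
      (∀ i, ψ i ∈ F) → (T : Set K) ⊆ F → ∀ i, x i ∈ F ∧ y i ∈ F := by
  classical
  by_cases hx : x = 0
  · obtain ⟨T, hT, h⟩ := exists_params_of_codim_two (k := k) hφp hψp hψq hφy hψy
    refine ⟨T, by omega, fun F hφF hψF hTF i => ⟨?_, h F hφF hψF hTF i⟩⟩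
    rw [hx]
    exact zero_mem F
  · obtain ⟨T, hT, h⟩ := exists_params_of_codim_two (k := k) hφp hψp hψq hφx hψx
    obtain ⟨a, ha⟩ := Function.ne_iff.1 hx
    rw [Pi.zero_apply] at ha
    refine ⟨insert (y a / x a) T, (Finset.card_insert_le _ _).trans hT, ?_⟩
    intro F hφF hψF hTF i
    rw [Finset.coe_insert, Set.insert_subset_iff] at hTF
    have hxi := h F hφF hψF hTF.2
    refine ⟨hxi i, ?_⟩
    have : y i = (y a / x a) * x i := by
      field_simp
      linear_combination hxy a i
    rw [this]
    exact mul_mem hTF.1 (hxi i)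

end Columns

/-- A matrix over an extension field at which all polynomials of `F_S` vanish has its entries in
a subfield generated by `2 * n + k₂ * n` elements, where `n + 1` is the number of rows. -/
theorem exists_finset_adjoin {k K : Type*} [Field k] [Field K] [Algebra k K] {n k₂ : ℕ}
    (S : Set (Col 2 k₂)) (hS : noColumn k₂ S) (v : Col 2 k₂ → Fin (n + 1) → K)
    (hzero : ∀ b ∈ S, v b = 0)
    (hpar : ∀ j, colOK k₂ S j → ∀ i i', v (0, j) i * v (1, j) i' = v (0, j) i' * v (1, j) i)
    (h₁ : ∃ φ : Fin (n + 1) → K, φ ≠ 0 ∧ ∀ b ∈ (rowSlice 2 k₂ 0 \ S) ∪ CSet k₂ S, φ ⬝ᵥ v b = 0)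
    (h₂ : ∃ φ : Fin (n + 1) → K, φ ≠ 0 ∧ ∀ b ∈ (rowSlice 2 k₂ 1 \ S) ∪ CSet k₂ S, φ ⬝ᵥ v b = 0)
    (h₃ : ∀ p, ∃ φ : Fin (n + 1) → K, φ ≠ 0 ∧ φ p = 0 ∧ ∀ b ∈ CSet k₂ S, φ ⬝ᵥ v b = 0) :
    ∃ T : Finset K, T.card ≤ 2 * n + k₂ * n ∧
      ∀ b i, v b i ∈ IntermediateField.adjoin k (T : Set K) := by
  classical
  obtain ⟨T₀, p, q, φ, ψ, χ, hT₀, hφp, hψp, hψq, hχ, hφF, hψF, hχF, hU₁, hC, hU₂⟩ :=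
    exists_normalized_functionals (k := k) v _ _ _ Set.subset_union_right
      Set.subset_union_right h₁ h₂ h₃
  have hφ : φ ≠ 0 := by
    rintro rfl
    simp at hφp
  have hcol : ∀ j : Fin k₂, ∃ T : Finset K, T.card ≤ n ∧ ∀ F : IntermediateField k K,
      (∀ i, φ i ∈ F) → (∀ i, ψ i ∈ F) → (∀ i, χ i ∈ F) → (T : Set K) ⊆ F →
      ∀ i, v (0, j) i ∈ F ∧ v (1, j) i ∈ F := by
    intro j
    by_cases hj0 : ((0 : Fin 2), j) ∈ S
    · have hj1 : ((1 : Fin 2), j) ∉ S := by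
        intro hj1
        refine hS j ?_
        rintro ⟨a, b⟩ (rfl : b = j)
        fin_cases a
        · exact hj0
        · exact hj1
      obtain ⟨T, hT, h⟩ := exists_params_of_hyperplane (k := k) hχ (hU₂ (1, j) (Or.inl ⟨rfl, hj1⟩))
      refine ⟨T, hT, fun F _ _ hχF hTF i => ⟨?_, h F hχF hTF i⟩⟩
      rw [hzero _ hj0]
      exact zero_mem F
    by_cases hj1 : ((1 : Fin 2), j) ∈ S
    · obtain ⟨T, hT, h⟩ := exists_params_of_hyperplane (k := k) hφ (hU₁ (0, j) (Or.inl ⟨rfl, hj0⟩))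
      refine ⟨T, hT, fun F hφF _ _ hTF i => ⟨h F hφF hTF i, ?_⟩⟩
      rw [hzero _ hj1]
      exact zero_mem F
    · have hj : colOK k₂ S j := by
        intro i
        fin_cases i
        · exact hj0
        · exact hj1
      obtain ⟨T, hT, h⟩ := exists_params_of_parallel (k := k) hφp hψp hψq
        (hU₁ (0, j) (Or.inr hj)) (hC (0, j) hj) (hU₁ (1, j) (Or.inr hj)) (hC (1, j) hj)
        (hpar j hj)
      exact ⟨T, hT, fun F hφF hψF _ hTF => h F hφF hψF hTF⟩
  choose T hT hmem using hcol
  refine ⟨T₀ ∪ Finset.univ.biUnion T, ?_, ?_⟩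
  · have i₁ := Finset.card_union_le T₀ (Finset.univ.biUnion T)
    have i₂ := Finset.card_biUnion_le_card_mul Finset.univ T n fun j _ => hT j
    simp only [Finset.card_univ, Fintype.card_fin] at i₂
    omega
  · set F := IntermediateField.adjoin k ((T₀ ∪ Finset.univ.biUnion T : Finset K) : Set K) with hFdef
    have hle : IntermediateField.adjoin k (T₀ : Set K) ≤ F :=
      IntermediateField.adjoin.mono _ _ _ (by simp)
    rintro ⟨a, j⟩ i
    have hTF : (T j : Set K) ⊆ F := by
      refine Set.Subset.trans ?_ (IntermediateField.subset_adjoin k _)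
      rw [Finset.coe_subset]
      exact (Finset.subset_biUnion_of_mem T (Finset.mem_univ j)).trans Finset.subset_union_right
    have := hmem j F (fun i => hle (hφF i)) (fun i => hle (hψF i)) (fun i => hle (hχF i)) hTF i
    fin_cases a
    · exact this.1
    · exact this.2

/-- If `S` contains no column slice and meets both rows, then `tCond` holds. -/
theorem tCond_of_noColumn {k₂ : ℕ} {S : Set (Col 2 k₂)} (hS : noColumn k₂ S)
    (hu : 1 ≤ uOf k₂ S) : tCond k₂ S := by
  have hboth : ∀ ℓ, ((0 : Fin 2), ℓ) ∈ S → ((1 : Fin 2), ℓ) ∈ S → False := by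
    intro ℓ h0 h1
    refine hS ℓ ?_
    rintro ⟨a, b⟩ (rfl : b = ℓ)
    fin_cases a
    · exact h0
    · exact h1
  have hrow : ∀ i, 1 ≤ (rowSlice 2 k₂ i ∩ S).ncard → ∃ ℓ, (i, ℓ) ∈ S := by
    intro i hi
    obtain ⟨⟨a, ℓ⟩, (rfl : a = i), hb⟩ :=
      Set.nonempty_of_ncard_ne_zero (Nat.one_le_iff_ne_zero.1 hi)
    exact ⟨ℓ, hb⟩
  obtain ⟨ℓ, hℓ⟩ := hrow 0 (hu.trans (min_le_left _ _))
  obtain ⟨m, hm⟩ := hrow 1 (hu.trans (min_le_right _ _))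
  exact ⟨⟨ℓ, hℓ, hboth ℓ hℓ⟩, ⟨m, hm, fun h => hboth m h hm⟩⟩

theorem map_minorPoly {K : Type*} [CommRing K] {d k₁ k₂ r : ℕ} (f : MvP d k₁ k₂ →+* K)
    (a : Fin r → Fin d) (b : Fin r → Col k₁ k₂) :
    f (minorPoly d k₁ k₂ r a b) = (Matrix.of fun i j => f (X (a i, b j))).det := by
  rw [minorPoly, RingHom.map_det]
  rfl

/-- A point with coordinates in an extension field of `ℂ` at which all polynomials of `F_S`
vanish has its coordinates in a field generated by at most `2 * n + k₂ * n` elements. -/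
theorem exists_finset_adjoin_of_ISIdeal_le_ker {K : Type*} [Field K] [Algebra ℂ K] {n k₂ : ℕ}
    {S : Set (Col 2 k₂)} (hS : noColumn k₂ S) (hu : 1 ≤ uOf k₂ S)
    (f : MvP (n + 1) 2 k₂ →ₐ[ℂ] K)
    (hf : ISIdeal (n + 1) k₂ (n + 1) S ≤ RingHom.ker f) :
    ∃ T : Finset K, T.card ≤ 2 * n + k₂ * n ∧
      ∀ x, f (X x) ∈ IntermediateField.adjoin ℂ (T : Set K) := by
  have hF : ∀ g ∈ FSset (n + 1) k₂ (n + 1) S, f g = 0 := fun g hg =>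
    hf (Ideal.subset_span hg)
  have hminor : ∀ {r : ℕ} {a : Fin r → Fin (n + 1)} {b : Fin r → Col 2 k₂},
      minorPoly (n + 1) 2 k₂ r a b ∈ FSset (n + 1) k₂ (n + 1) S →
      (Matrix.of fun i j => f (X (a i, b j))).det = 0 := by
    intro r a b h
    rw [← hF _ h]
    exact (map_minorPoly f.toRingHom a b).symm
  refine (exists_finset_adjoin (k := ℂ) S hS (fun b i => f (X (i, b))) ?_ ?_ ?_ ?_ ?_).imp
    fun T hT => ⟨hT.1, fun x => hT.2 x.2 x.1⟩
  · intro b hb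
    ext i
    have := hminor (r := 1) (a := fun _ => i) (b := fun _ => b)
      (Or.inl (Or.inl (Or.inl (Or.inl ⟨_, _, Function.injective_of_subsingleton _,
        Function.injective_of_subsingleton _, fun _ => hb, rfl⟩))))
    simpa using this
  · intro j hj i i'
    by_cases hi : i = i'
    · rw [hi]
    have := hminor (r := 2) (a := ![i, i']) (b := ![(0, j), (1, j)])
      (Or.inl (Or.inl (Or.inl (Or.inr (Set.mem_biUnion (x := j) hj ⟨_, _, ?_, ?_, ?_, rfl⟩)))))
    · rw [Matrix.det_fin_two] at this
      simp only [Matrix.of_apply, Matrix.cons_val_zero, Matrix.cons_val_one] at this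
      linear_combination this
    · intro x y hxy
      fin_cases x <;> fin_cases y <;> simp_all
    · intro x y hxy
      fin_cases x <;> fin_cases y <;> simp_all
    · intro x
      fin_cases x <;> rfl
  · exact exists_dotProduct_eq_zero _ _ fun b hb hbU =>
      hminor (a := id) (Or.inl (Or.inr ⟨_, b, Function.injective_id, hb, hbU, rfl⟩))
  · exact exists_dotProduct_eq_zero _ _ fun b hb hbU =>
      hminor (a := id) (Or.inr ⟨_, b, Function.injective_id, hb, hbU, rfl⟩)
  · intro p
    obtain ⟨φ, hφ, hφC⟩ := exists_dotProduct_eq_zero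
      (fun b (i : Fin n) => f (X (p.succAbove i, b))) (CSet k₂ S) fun b hb hbU =>
      hminor (a := p.succAbove) (Or.inl (Or.inl (Or.inr (Set.mem_iUnion.2
        ⟨tCond_of_noColumn hS hu, _, b, Fin.succAbove_right_injective, hb, hbU, rfl⟩))))
    refine ⟨p.insertNth 0 φ, ?_, by simp, ?_⟩
    · intro h0
      apply hφ
      ext i
      simpa using congrFun h0 (p.succAbove i)
    · intro b hb
      have := hφC b hb
      rw [dotProduct] at this ⊢
      rw [Fin.sum_univ_succAbove _ p]
      simpa using this


/-- for `k₁ = 2`, `d = t`, `2 ≤ t ≤ k₂`, and every minimal nonempty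
`S ⊆ [2]×[k₂]`, the Krull dimension of `ℂ[X]/I_S` is at most
`t² + (t−1)k₂ − (t−1)² − 1`. -/
theorem ISIdeal_krullDim_le
    (d k₂ t : ℕ) (hd : d = t) (ht : 2 ≤ t) (htk : t ≤ k₂)
    (S : Set (Col 2 k₂)) (hS : minimalSubset k₂ t S) (hne : S ≠ ∅) :
    ringKrullDim (MvP d 2 k₂ ⧸ ISIdeal d k₂ t S) ≤
      ((t ^ 2 + (t - 1) * k₂ - (t - 1) ^ 2 - 1 : ℕ) : WithBot ℕ∞) := by
  subst hd
  obtain ⟨n, rfl⟩ : ∃ n, d = n + 1 := ⟨d - 1, by omega⟩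
  obtain ⟨hcol, hu, -⟩ := hS.resolve_left hne
  have hD : (n + 1) ^ 2 + (n + 1 - 1) * k₂ - (n + 1 - 1) ^ 2 - 1 = 2 * n + k₂ * n := by
    have : (n + 1) ^ 2 + n * k₂ = 2 * n + k₂ * n + 1 + n ^ 2 := by ring
    rw [Nat.add_sub_cancel, this]
    omega
  rw [hD]
  refine ringKrullDim_quotient_le_of_forall_isPrime _ _ fun P hP hIP => ?_
  let K := FractionRing (MvP (n + 1) 2 k₂ ⧸ P)
  let ι : (MvP (n + 1) 2 k₂ ⧸ P) →ₐ[ℂ] K := Algebra.algHom ℂ _ K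
  have hι : Function.Injective ι := IsFractionRing.injective (MvP (n + 1) 2 k₂ ⧸ P) K
  let f : MvP (n + 1) 2 k₂ →ₐ[ℂ] K := ι.comp (Ideal.Quotient.mkₐ ℂ P)
  obtain ⟨T, hT, hmem⟩ := exists_finset_adjoin_of_ISIdeal_le_ker hcol hu f (by
    intro g hg
    have h0 : Ideal.Quotient.mkₐ ℂ P g = 0 := Ideal.Quotient.eq_zero_iff_mem.2 (hIP hg)
    rw [RingHom.mem_ker, AlgHom.comp_apply, h0, map_zero])
  have hf : ∀ g, f g ∈ IntermediateField.adjoin ℂ (T : Set K) := by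
    intro g
    induction g using MvPolynomial.induction_on with
    | C a =>
      rw [← MvPolynomial.algebraMap_eq, AlgHom.commutes]
      exact IntermediateField.algebraMap_mem _ a
    | add p q hp hq => rw [map_add]; exact add_mem hp hq
    | mul_X p i hp => rw [map_mul]; exact mul_mem hp (hmem i)
  have htop : IntermediateField.adjoin ℂ (T : Set K) = ⊤ := by
    rw [eq_top_iff]
    intro x _
    obtain ⟨a, b, -, rfl⟩ := IsFractionRing.div_surjective (MvP (n + 1) 2 k₂ ⧸ P) x
    obtain ⟨a, rfl⟩ := Ideal.Quotient.mk_surjective a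
    obtain ⟨b, rfl⟩ := Ideal.Quotient.mk_surjective b
    exact div_mem (hf a) (hf b)
  refine ringKrullDim_le_of_trdeg_le ℂ _ _ ((trdeg_le_of_injective ι hι).trans
    ((trdeg_le_card_of_adjoin_eq_top T htop).trans ?_))
  exact_mod_cast hT

end CI
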